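/- With margin vectors a ∈ ℕ^m, b ∈ ℕ^n satisfying N = Σ a_i = Σ b_j, one has dim_ℂ SI(𝒮, β)_{σ_{a,b}} = dim_ℂ SI(𝒮̃, β̃)_{σ̃_{a,b}}, where 𝒮̃ is the quiver obtained from the star quiver 𝒮 by reflecting at the source vertices x₁,…,x_{m+p} (reversing all their arrows), β̃ is the dimension vector with β̃(x_i) = pm−1 for i ∈ [m], β̃(x_{m+ℓ}) = m(p−1) for ℓ ∈ [p], β̃(z₀) = pm, β̃(y_j) = 1 for j ∈ [n], and σ̃_{a,b} is the weight with σ̃_{a,b}(x_i) = −a_i for i ∈ [m], σ̃_{a,b}(x_{m+ℓ}) = −N for ℓ ∈ [p], σ̃_{a,b}(z₀) = pN, σ̃_{a,b}(y_j) = −b_j for j ∈ [n]. -/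

import Mathlib

/-- A finite quiver: finite sets of vertices and arrows with tail and head maps. -/
structure FinQuiver where
  V : Type
  A : Type
  [instFinV : Fintype V]
  [instDecV : DecidableEq V]
  [instFinA : Fintype A]
  [instDecA : DecidableEq A]
  t : A → V
  h : A → V

attribute [instance] FinQuiver.instFinV FinQuiver.instDecV FinQuiver.instFinA FinQuiver.instDecA

/-- Coerce an `ℕ`-valued function (dimension vector) to a `ℤ`-valued one. -/
def natToInt {X : Type} (α : X → ℕ) : X → ℤ := fun x => (α x : ℤ)

namespace FinQuiver

variable (Q : FinQuiver)

/-- `Q` has an oriented cycle. -/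
def HasCycle : Prop :=
  ∃ k : ℕ, ∃ c : Fin (k + 1) → Q.A, ∀ i : Fin (k + 1), Q.h (c i) = Q.t (c (i + 1))

/-- `Q` is acyclic: it has no oriented cycles. -/
def Acyclic : Prop := ¬ Q.HasCycle

/-- Two vertices are adjacent if some arrow joins them (in either direction). -/
def Adj (u v : Q.V) : Prop :=
  ∃ a : Q.A, (Q.t a = u ∧ Q.h a = v) ∨ (Q.t a = v ∧ Q.h a = u)

/-- `Q` is connected as an undirected graph. -/
def Connected : Prop := ∀ u v : Q.V, Relation.ReflTransGen Q.Adj u v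

/-- The representation space `rep(Q, β)`. -/
def Rep (β : Q.V → ℕ) : Type :=
  ∀ a : Q.A, Matrix (Fin (β (Q.h a))) (Fin (β (Q.t a))) ℂ

/-- The group `GL(β) = ∏ₓ GL(β(x), ℂ)`. -/
def GLb (β : Q.V → ℕ) : Type :=
  ∀ x : Q.V, (Matrix (Fin (β x)) (Fin (β x)) ℂ)ˣ

/-- The action of `g⁻¹ ∈ GL(β)` on `W ∈ rep(Q,β)`: `(g⁻¹ · W)ₐ = g_{ha}⁻¹ Wₐ g_{ta}`. -/
noncomputable def invAct {β : Q.V → ℕ} (g : Q.GLb β) (W : Q.Rep β) : Q.Rep β :=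
  fun a => ((g (Q.h a))⁻¹).val * W a * (g (Q.t a)).val

/-- `f : rep(Q,β) → ℂ` is a polynomial function of the matrix entries. -/
def IsPolyFun {β : Q.V → ℕ} (f : Q.Rep β → ℂ) : Prop :=
  ∃ P : MvPolynomial ((a : Q.A) × (Fin (β (Q.h a)) × Fin (β (Q.t a)))) ℂ,
    ∀ W : Q.Rep β, f W = MvPolynomial.eval (fun i => W i.1 i.2.1 i.2.2) P

/-- The character `∏ₓ det(gₓ)^{σ(x)}` of `GL(β)` attached to an integral weight `σ`. -/
noncomputable def detWeight {β : Q.V → ℕ} (σ : Q.V → ℤ) (g : Q.GLb β) : ℂ :=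
  ∏ x : Q.V, (Matrix.det (g x).val) ^ (σ x)

/-- The space `SI(Q,β)_σ` of semi-invariants of weight `σ`: polynomial functions `f` on
`rep(Q,β)` with `f(g⁻¹ · W) = (∏ₓ det(gₓ)^{σ(x)}) f(W)` for all `g ∈ GL(β)`. -/
noncomputable def SIw (β : Q.V → ℕ) (σ : Q.V → ℤ) : Submodule ℂ (Q.Rep β → ℂ) where
  carrier := {f | Q.IsPolyFun f ∧
    ∀ (g : Q.GLb β) (W : Q.Rep β), f (Q.invAct g W) = Q.detWeight σ g * f W}
  add_mem' := by
    rintro f₁ f₂ ⟨⟨P₁, hP₁⟩, h₁⟩ ⟨⟨P₂, hP₂⟩, h₂⟩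
    refine ⟨⟨P₁ + P₂, fun W => ?_⟩, fun g W => ?_⟩
    · simp [Pi.add_apply, hP₁ W, hP₂ W]
    · simp only [Pi.add_apply, h₁ g W, h₂ g W]; ring
  zero_mem' := by
    refine ⟨⟨0, fun W => ?_⟩, fun g W => ?_⟩ <;> simp
  smul_mem' := by
    rintro c f ⟨⟨P, hP⟩, hf⟩
    refine ⟨⟨MvPolynomial.C c * P, fun W => ?_⟩, fun g W => ?_⟩
    · simp [Pi.smul_apply, hP W, smul_eq_mul]
    · simp only [Pi.smul_apply, hf g W, smul_eq_mul]; ring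

/-- The dimension of the weight space of semi-invariants `SI(Q,β)_σ`. -/
noncomputable def siDim (β : Q.V → ℕ) (σ : Q.V → ℤ) : ℕ :=
  Module.finrank ℂ (Q.SIw β σ)

/-- The Euler (Ringel) form of `Q`. -/
def euler (α γ : Q.V → ℤ) : ℤ :=
  (∑ x : Q.V, α x * γ x) - ∑ a : Q.A, α (Q.t a) * γ (Q.h a)

/-- The weight `⟨α, ·⟩ : x ↦ ⟨α, eₓ⟩` attached to a dimension vector `α`. -/
def weightOf (α : Q.V → ℕ) : Q.V → ℤ :=
  fun x => (α x : ℤ) - ∑ a : Q.A, (if Q.h a = x then (α (Q.t a) : ℤ) else 0)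

/-- `(α ∘ β)_Q := dim SI(Q,β)_{⟨α,·⟩}`. -/
noncomputable def circ (α β : Q.V → ℕ) : ℕ := Q.siDim β (Q.weightOf α)

/-- `φ` is a morphism of representations `V → W`. -/
def IsHom {α γ : Q.V → ℕ} (V : Q.Rep α) (W : Q.Rep γ)
    (φ : ∀ x : Q.V, Matrix (Fin (γ x)) (Fin (α x)) ℂ) : Prop :=
  ∀ a : Q.A, φ (Q.h a) * V a = W a * φ (Q.t a)

/-- The space `Hom_Q(V, W)` of morphisms of representations. -/
noncomputable def homSpace {α γ : Q.V → ℕ} (V : Q.Rep α) (W : Q.Rep γ) :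
    Submodule ℂ (∀ x : Q.V, Matrix (Fin (γ x)) (Fin (α x)) ℂ) where
  carrier := {φ | Q.IsHom V W φ}
  add_mem' := by
    intro φ ψ hφ hψ a
    simp only [Pi.add_apply, Matrix.add_mul, Matrix.mul_add, hφ a, hψ a]
  zero_mem' := by
    intro a
    simp
  smul_mem' := by
    intro c φ hφ a
    simp only [Pi.smul_apply, Matrix.smul_mul, Matrix.mul_smul, hφ a]

/-- A representation is Schur if its endomorphism algebra is one-dimensional. -/
def IsSchur {α : Q.V → ℕ} (V : Q.Rep α) : Prop :=
  Module.finrank ℂ (Q.homSpace V V) = 1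

/-- A quiver exceptional sequence of dimension vectors. -/
def IsExcSeq {Nn : ℕ} (ε : Fin Nn → (Q.V → ℕ)) : Prop :=
  (∀ i, Q.euler (natToInt (ε i)) (natToInt (ε i)) = 1 ∧ ∃ V : Q.Rep (ε i), Q.IsSchur V) ∧
  ∀ i j : Fin Nn, i < j →
    Q.euler (natToInt (ε i)) (natToInt (ε j)) ≤ 0 ∧ Q.circ (ε j) (ε i) ≠ 0

/-- The quiver `Q(ℰ)` attached to a sequence `ℰ = (ε₁,…,ε_N)` of dimension vectors:
vertices `1,…,N` and `−⟨εᵢ, εⱼ⟩` arrows from `i` to `j` for `i ≠ j`. -/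
def quiverOfSeq {Nn : ℕ} (ε : Fin Nn → (Q.V → ℕ)) : FinQuiver where
  V := Fin Nn
  A := (i : Fin Nn) × (j : Fin Nn) ×
        Fin (if i = j then 0 else (-(Q.euler (natToInt (ε i)) (natToInt (ε j)))).toNat)
  t := fun a => a.1
  h := fun a => a.2.1

end FinQuiver

/-- An isomorphism of quivers. -/
structure QuiverIso (Q₁ Q₂ : FinQuiver) where
  vEquiv : Q₁.V ≃ Q₂.V
  aEquiv : Q₁.A ≃ Q₂.A
  t_comm : ∀ a : Q₁.A, Q₂.t (aEquiv a) = vEquiv (Q₁.t a)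
  h_comm : ∀ a : Q₁.A, Q₂.h (aEquiv a) = vEquiv (Q₁.h a)

/-- The `p`-complete bipartite quiver `Q^p_{m,n}`: sources `x₁,…,x_m`, sinks `y₁,…,y_n`,
and `p` arrows from each `xᵢ` to each `yⱼ`. -/
def Qpmn (m n p : ℕ) : FinQuiver where
  V := Fin m ⊕ Fin n
  A := Fin m × Fin n × Fin p
  t := fun a => Sum.inl a.1
  h := fun a => Sum.inr a.2.1

/-- The number `T_{a,b}` of 3-way contingency tables of size `m × n × p` with the two
plane-sum margins fixed by `a` and `b`. -/
noncomputable def numTables (m n p : ℕ) (a : Fin m → ℕ) (b : Fin n → ℕ) : ℕ :=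
  Nat.card {x : Fin m × Fin n × Fin p → ℕ //
    (∀ i : Fin m, ∑ j : Fin n, ∑ k : Fin p, x (i, j, k) = a i) ∧
    (∀ j : Fin n, ∑ i : Fin m, ∑ k : Fin p, x (i, j, k) = b j)}

/-- The weight `θ_{a,b}` of `Q^p_{m,n}`. -/
def thetaAB {m n : ℕ} (a : Fin m → ℕ) (b : Fin n → ℕ) : Fin m ⊕ Fin n → ℤ :=
  Sum.elim (fun i => (a i : ℤ)) (fun j => -(b j : ℤ))

/-- The vertices of the star quiver `𝒮`: sources `x₁,…,x_{m+p}`, center `z₀`,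
sinks `y₁,…,y_n`. -/
inductive SVert (m p n : ℕ) : Type where
  | x : Fin (m + p) → SVert m p n
  | z0 : SVert m p n
  | y : Fin n → SVert m p n
  deriving DecidableEq, Fintype

/-- The star quiver `𝒮` with arrows `x_ℓ → z₀` (`ℓ ∈ [m+p]`) and `z₀ → y_j` (`j ∈ [n]`). -/
def Squiv (m p n : ℕ) : FinQuiver where
  V := SVert m p n
  A := Fin (m + p) ⊕ Fin n
  t := Sum.elim (fun ℓ => SVert.x ℓ) (fun _ => SVert.z0)
  h := Sum.elim (fun _ => SVert.z0) (fun j => SVert.y j)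

/-- The dimension vector `β` of `𝒮`: value `1` at `x₁,…,x_m`, `m` at `x_{m+1},…,x_{m+p}`,
`mp` at `z₀`, `1` at the `y_j`. -/
def betaS (m p n : ℕ) : SVert m p n → ℕ
  | .x ℓ => if ℓ.val < m then 1 else m
  | .z0 => m * p
  | .y _ => 1

/-- The weight `σ_{a,b}` of `𝒮`: `a_ℓ` at `x_ℓ` (`ℓ ∈ [m]`), `N` at `x_{m+1},…,x_{m+p}`,
`−N` at `z₀`, `−b_j` at `y_j`. -/
def sigmaS (m p n : ℕ) (a : Fin m → ℕ) (b : Fin n → ℕ) (N : ℕ) : SVert m p n → ℤ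
  | .x ℓ => if h : ℓ.val < m then (a ⟨ℓ.val, h⟩ : ℤ) else (N : ℤ)
  | .z0 => -(N : ℤ)
  | .y j => -(b j : ℤ)

/-- The quiver `𝒮̃` obtained from `𝒮` by reflecting at the source vertices
`x₁,…,x_{m+p}`: arrows `z₀ → x_ℓ` (`ℓ ∈ [m+p]`) and `z₀ → y_j` (`j ∈ [n]`). -/
def StildeQuiv (m p n : ℕ) : FinQuiver where
  V := SVert m p n
  A := Fin (m + p) ⊕ Fin n
  t := fun _ => SVert.z0
  h := Sum.elim (fun ℓ => SVert.x ℓ) (fun j => SVert.y j)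

/-- The dimension vector `β̃` of `𝒮̃`: `pm − 1` at `x₁,…,x_m`, `m(p−1)` at
`x_{m+1},…,x_{m+p}`, `pm` at `z₀`, `1` at the `y_j`. -/
def betaStilde (m p n : ℕ) : SVert m p n → ℕ
  | .x ℓ => if ℓ.val < m then p * m - 1 else m * (p - 1)
  | .z0 => p * m
  | .y _ => 1

/-- The weight `σ̃_{a,b}` of `𝒮̃`: `−a_i` at `x_i` (`i ∈ [m]`), `−N` at
`x_{m+1},…,x_{m+p}`, `pN` at `z₀`, `−b_j` at `y_j`. -/
def sigmaStilde (m p n : ℕ) (a : Fin m → ℕ) (b : Fin n → ℕ) (N : ℕ) : SVert m p n → ℤ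
  | .x ℓ => if h : ℓ.val < m then -(a ⟨ℓ.val, h⟩ : ℤ) else -(N : ℤ)
  | .z0 => (p : ℤ) * (N : ℤ)
  | .y j => -(b j : ℤ)

namespace Refl
set_option linter.unusedSectionVars false
open MvPolynomial

section general
variable {σ : Type}

lemma density {P Q D : MvPolynomial σ ℂ} (hD : D ≠ 0)
    (h : ∀ x, eval x D ≠ 0 → eval x P = eval x Q) : P = Q := by
  have : (P - Q) * D = 0 := by
    apply MvPolynomial.funext
    intro x
    by_cases hx : eval x D = 0
    · simp [hx]
    · simp [h x hx]
  rcases mul_eq_zero.1 this with h | h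
  · exact sub_eq_zero.1 h
  · exact absurd h hD

lemma notMem_vars_of_eval [DecidableEq σ] {P : MvPolynomial σ ℂ} {s : σ}
    (h : ∀ x t, eval (Function.update x s t) P = eval x P) : s ∉ P.vars := by
  have h1 : P = bind₁ (Function.update X s (C 0)) P := by
    apply MvPolynomial.funext
    intro x
    rw [← h x 0]
    rw [← coe_aeval_eq_eval, ← coe_aeval_eq_eval]
    simp only [RingHom.coe_coe, aeval_bind₁]
    congr 2
    funext i
    by_cases hi : i = s
    · subst hi; simp
    · simp [hi]
  intro hs
  rw [h1] at hs
  obtain ⟨i, -, hi⟩ := mem_vars_bind₁ _ _ hs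
  by_cases his : i = s
  · subst his; simp at hi
  · simp [his] at hi; exact his hi.symm

lemma notMem_vars_iff {P : MvPolynomial σ ℂ} {s : σ} : s ∉ P.vars ↔ degreeOf s P = 0 := by
  classical
  rw [vars_def, Multiset.mem_toFinset, degreeOf_def, Multiset.count_eq_zero]

lemma notMem_vars_of_dvd {q D : MvPolynomial σ ℂ} {s : σ} (hq : q ∣ D) (hD : D ≠ 0)
    (h : s ∉ D.vars) : s ∉ q.vars := by
  obtain ⟨c, rfl⟩ := hq
  rw [notMem_vars_iff] at *
  rw [degreeOf_mul_eq (left_ne_zero_of_mul hD) (right_ne_zero_of_mul hD)] at h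
  omega

lemma isUnit_of_vars {q : MvPolynomial σ ℂ} (hq : q ≠ 0) (h : ∀ s, s ∉ q.vars) : IsUnit q := by
  have : q.vars = ∅ := Finset.eq_empty_of_forall_notMem h
  rw [vars_eq_empty_iff_eq_C] at this
  rw [this]
  refine (IsUnit.mk0 _ ?_).map C
  intro h0
  rw [h0] at this
  simp at this
  exact hq this

end general

variable {L ι τ : Type} [Fintype L] [DecidableEq L] [Fintype ι] [DecidableEq ι] [DecidableEq τ]

/-- The matrices of a point. -/
def mat {R : Type} (x : (L × ι × ι) ⊕ τ → R) (l : L) : Matrix ι ι R :=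
  Matrix.of fun r c => x (Sum.inl (l, r, c))

/-- The point of a family of matrices. -/
def pt {R : Type} (M : L → Matrix ι ι R) (w : τ → R) : (L × ι × ι) ⊕ τ → R :=
  Sum.elim (fun i => M i.1 i.2.1 i.2.2) w

lemma mat_pt {R : Type} (M : L → Matrix ι ι R) (w : τ → R) : mat (pt M w) = M := rfl

lemma pt_mat {R : Type} (x : (L × ι × ι) ⊕ τ → R) : pt (mat x) (x ∘ Sum.inr) = x := by
  funext i
  rcases i with ⟨l, r, c⟩ | t <;> rfl

/-- determinant polynomial -/
noncomputable def detP (l : L) : MvPolynomial ((L × ι × ι) ⊕ τ) ℂ :=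
  (mat X l).det

lemma eval_detP (x : (L × ι × ι) ⊕ τ → ℂ) (l : L) : eval x (detP l) = (mat x l).det := by
  unfold detP
  rw [RingHom.map_det]
  congr 1
  ext r c
  simp [mat]

/-- glue -/
def glue {R : Type} (S : L → ι → Bool) (T : L × ι × ι → R) (x : (L × ι × ι) ⊕ τ → R) :
    (L × ι × ι) ⊕ τ → R
  | .inl i => if S i.1 i.2.1 then x (.inl i) else T i
  | .inr t => x (.inr t)

/-- glued substitution -/
noncomputable def glueP (S : L → ι → Bool) :
    (L × ι × ι) ⊕ τ → MvPolynomial ((L × ι × ι) ⊕ ((L × ι × ι) ⊕ τ)) ℂ :=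
  glue S (fun i => X (Sum.inl i)) (fun v => X (Sum.inr v))

lemma eval_glueP (S : L → ι → Bool) (y : (L × ι × ι) ⊕ ((L × ι × ι) ⊕ τ) → ℂ)
    (P : MvPolynomial ((L × ι × ι) ⊕ τ) ℂ) :
    eval y (bind₁ (glueP S) P) = eval (glue S (y ∘ Sum.inl) (y ∘ Sum.inr)) P := by
  rw [← coe_aeval_eq_eval, ← coe_aeval_eq_eval]
  simp only [RingHom.coe_coe, aeval_bind₁]
  congr 2
  funext i
  rcases i with i | t
  · simp only [glueP, glue]
    split_ifs <;> simp
  · simp [glueP, glue]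

lemma eval_ren (y : (L × ι × ι) ⊕ ((L × ι × ι) ⊕ τ) → ℂ)
    (P : MvPolynomial ((L × ι × ι) ⊕ τ) ℂ) :
    eval y (rename Sum.inr P) = eval (y ∘ Sum.inr) P := by
  rw [eval_rename]

lemma detP_ne_zero (l : L) : (detP l : MvPolynomial ((L × ι × ι) ⊕ τ) ℂ) ≠ 0 := by
  intro h
  have := eval_detP (τ := τ) (pt (fun _ => (1 : Matrix ι ι ℂ)) (fun _ => 0)) l
  rw [h, mat_pt] at this
  simp at this

lemma det_glueP_ne_zero (S : L → ι → Bool) (l : L) :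
    bind₁ (glueP S) (detP l : MvPolynomial ((L × ι × ι) ⊕ τ) ℂ) ≠ 0 := by
  intro h
  have := eval_glueP (τ := τ) S (Sum.elim (fun i => if i.2.1 = i.2.2 then 1 else 0)
    (pt (fun _ => (1 : Matrix ι ι ℂ)) (fun _ => 0))) (detP l)
  rw [h, eval_detP] at this
  have h2 : mat (glue S (fun i => if i.2.1 = i.2.2 then 1 else 0)
    (pt (fun _ => (1 : Matrix ι ι ℂ)) (fun _ : τ => 0))) l = 1 := by
    ext r c
    simp [mat, glue, pt, Matrix.one_apply]
  simp only [Sum.elim_comp_inl, Sum.elim_comp_inr] at this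
  rw [h2] at this
  simp at this

/-- coprimality -/
lemma relPrime (S : L → ι → Bool) (l l' : L) (k0 : ι) (hk : S l k0 = false) :
    IsRelPrime (rename Sum.inr (detP l : MvPolynomial ((L × ι × ι) ⊕ τ) ℂ))
      (bind₁ (glueP S) (detP l')) := by
  intro q h1 h2
  have hD1 : rename Sum.inr (detP l : MvPolynomial ((L × ι × ι) ⊕ τ) ℂ) ≠ (0 : MvPolynomial ((L × ι × ι) ⊕ ((L × ι × ι) ⊕ τ)) ℂ) := by
    rw [Ne, map_eq_zero_iff _ (rename_injective _ Sum.inr_injective)]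
    exact detP_ne_zero l
  have hD2 := det_glueP_ne_zero (τ := τ) S l'
  have hq : q ≠ 0 := by rintro rfl; exact hD1 (zero_dvd_iff.1 h1)
  -- variables not in the first determinant
  have a1 : ∀ s, (∀ r c, s ≠ Sum.inr (Sum.inl (l, r, c))) → s ∉ q.vars := by
    intro s hs
    apply notMem_vars_of_dvd h1 hD1
    apply notMem_vars_of_eval
    intro x t
    rw [eval_ren, eval_ren, eval_detP, eval_detP]
    congr 1
    ext r c
    simp only [mat, Matrix.of_apply, Function.comp]
    rw [Function.update_of_ne (hs r c).symm]
  have a2 : ∀ r c, ¬ (l = l' ∧ S l r = true) →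
      (Sum.inr (Sum.inl (l, r, c)) : (L × ι × ι) ⊕ ((L × ι × ι) ⊕ τ)) ∉ q.vars := by
    intro r c hs
    apply notMem_vars_of_dvd h2 hD2
    apply notMem_vars_of_eval
    intro x t
    rw [eval_glueP, eval_glueP, eval_detP, eval_detP]
    congr 1
    ext r' c'
    simp only [mat, glue, Matrix.of_apply, Function.comp]
    split_ifs with hS
    · rw [Function.update_of_ne]
      rintro h
      simp only [Sum.inr.injEq, Sum.inl.injEq, Prod.mk.injEq] at h
      obtain ⟨rfl, rfl, rfl⟩ := h
      exact hs ⟨rfl, hS⟩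
    · rw [Function.update_of_ne (by simp)]
  apply isUnit_of_vars hq
  intro s
  by_cases hs : ∀ r c, s ≠ Sum.inr (Sum.inl (l, r, c))
  · exact a1 s hs
  push Not at hs
  obtain ⟨r, c, rfl⟩ := hs
  by_cases hrow : S l r = true
  swap
  · exact a2 r c (fun h => hrow h.2)
  -- the specialisation
  let θ : (L × ι × ι) ⊕ ((L × ι × ι) ⊕ τ) → MvPolynomial ((L × ι × ι) ⊕ ((L × ι × ι) ⊕ τ)) ℂ
    | .inl i => X (.inl i)
    | .inr (.inl i) => if i.1 = l ∧ i.2.1 = k0 then C (if i.2.2 = c then 1 else 0) else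
        X (.inr (.inl i))
    | .inr (.inr t) => X (.inr (.inr t))
  have hθq : bind₁ θ q = q := by
    have : bind₁ θ q = bind₁ X q := by
      refine eval₂Hom_congr' rfl ?_ rfl
      intro i hi _
      rcases i with i | i | t
      · rfl
      · obtain ⟨l1, r1, c1⟩ := i
        simp only [θ]
        by_cases h : l1 = l ∧ r1 = k0
        · exfalso
          obtain ⟨h3, h4⟩ := h
          subst h3 h4
          exact a2 _ _ (fun h => by simp [hk] at h) hi
        · rw [if_neg h]
      · rfl
    rw [this, bind₁_X_left, AlgHom.id_apply]
  rw [← hθq]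
  have hev : ∀ y : (L × ι × ι) ⊕ ((L × ι × ι) ⊕ τ) → ℂ,
      eval y (bind₁ θ (rename Sum.inr (detP l : MvPolynomial ((L × ι × ι) ⊕ τ) ℂ))) =
        ((mat (y ∘ Sum.inr) l).updateRow k0 (Pi.single c 1)).det := by
    intro y
    have : eval y (bind₁ θ (rename Sum.inr (detP l : MvPolynomial ((L × ι × ι) ⊕ τ) ℂ))) =
        eval (fun i => eval y (θ i)) (rename Sum.inr (detP l : MvPolynomial ((L × ι × ι) ⊕ τ) ℂ)) := by
      rw [← coe_aeval_eq_eval, ← coe_aeval_eq_eval]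
      simp only [RingHom.coe_coe, aeval_bind₁]
    rw [this, eval_ren, eval_detP]
    congr 1
    ext r' c'
    simp only [mat, Matrix.of_apply, Function.comp, θ, true_and, Matrix.updateRow_apply]
    split_ifs with h3 h4
    · subst h4; simp
    · simp [h4]
    · simp
  apply notMem_vars_of_dvd (map_dvd (bind₁ θ) h1)
  · intro h
    have := hev (Sum.elim (fun _ => 0) (pt (fun _ => (Equiv.swap k0 c).permMatrix ℂ) (fun _ => 0)))
    rw [h, Sum.elim_comp_inr, mat_pt] at this
    have h5 : ((Equiv.swap k0 c).permMatrix ℂ).updateRow k0 (Pi.single c 1) =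
        (Equiv.swap k0 c).permMatrix ℂ := by
      ext i j
      rw [Matrix.updateRow_apply]
      split_ifs with h6
      · subst h6
        simp [Equiv.Perm.permMatrix, PEquiv.toMatrix_apply, Pi.single_apply, eq_comm]
      · rfl
    rw [h5, Matrix.det_permutation] at this
    rcases Int.units_eq_one_or (Equiv.Perm.sign (Equiv.swap k0 c)) with h7 | h7 <;>
      simp [h7] at this
  · apply notMem_vars_of_eval
    intro x t
    rw [hev, hev]
    have hrk : r ≠ k0 := by rintro rfl; rw [hk] at hrow; simp at hrow
    set A := (mat (x ∘ Sum.inr) l).updateRow k0 (Pi.single c 1) with hA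
    rw [← Matrix.det_updateRow_add_smul_self A hrk
      (t - x (Sum.inr (Sum.inl (l, r, c))))]
    congr 1
    ext r' c'
    by_cases h8 : r' = k0
    · subst h8
      simp [Matrix.updateRow_apply, hrk.symm, hA]
    · by_cases h9 : r' = r
      · subst h9
        simp only [Matrix.updateRow_apply, hA, h8, if_true, if_false, Pi.add_apply, Pi.smul_apply,
          mat, Matrix.of_apply, Function.comp]
        by_cases h10 : c' = c
        · subst h10; simp
        · rw [Function.update_of_ne (by simp [h10])]
          simp [h10]
      · simp only [Matrix.updateRow_apply, hA, h8, h9, if_false,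
          mat, Matrix.of_apply, Function.comp]
        rw [Function.update_of_ne (by simp [h9])]

end Refl
namespace Refl
open MvPolynomial
set_option linter.unusedSectionVars false
variable {L ι τ : Type} [Fintype L] [DecidableEq L] [Fintype ι] [DecidableEq ι] [DecidableEq τ]

/-- The transformed function on invertible matrices. -/
noncomputable def hatF (N : L → ℕ) (P : MvPolynomial ((L × ι × ι) ⊕ τ) ℂ)
    (M : L → Matrix ι ι ℂ) (w : τ → ℂ) : ℂ :=
  (∏ l, (M l).det ^ N l) * eval (pt (fun l => (M l)⁻¹) w) P

/-- `P` is invariant of weight `N` under block triangular matrices. -/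
def EqvR (S : L → ι → Bool) (N : L → ℕ) (P : MvPolynomial ((L × ι × ι) ⊕ τ) ℂ) : Prop :=
  ∀ (h X : L → Matrix ι ι ℂ) (w : τ → ℂ), (∀ l, (h l).det ≠ 0) →
    (∀ l r c, S l r = true → h l r c = (1 : Matrix ι ι ℂ) r c) →
    eval (pt (fun l => X l * h l) w) P = (∏ l, (h l).det ^ N l) * eval (pt X w) P

/-- `P` depends only on the columns outside `S`. -/
def DepC (S : L → ι → Bool) (P : MvPolynomial ((L × ι × ι) ⊕ τ) ℂ) : Prop :=
  ∀ (X X' : L → Matrix ι ι ℂ) (w : τ → ℂ),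
    (∀ l r c, S l c = false → X l r c = X' l r c) → eval (pt X w) P = eval (pt X' w) P

/-- `P` depends only on the rows in `S`. -/
def DepR (S : L → ι → Bool) (P : MvPolynomial ((L × ι × ι) ⊕ τ) ℂ) : Prop :=
  ∀ (X X' : L → Matrix ι ι ℂ) (w : τ → ℂ),
    (∀ l r c, S l r = true → X l r c = X' l r c) → eval (pt X w) P = eval (pt X' w) P

lemma hatF_congr {S : L → ι → Bool} {N : L → ℕ} {P : MvPolynomial ((L × ι × ι) ⊕ τ) ℂ}
    (he : EqvR S N P) {M M' : L → Matrix ι ι ℂ} (w : τ → ℂ)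
    (hM : ∀ l, (M l).det ≠ 0) (hM' : ∀ l, (M' l).det ≠ 0)
    (h : ∀ l r c, S l r = true → M l r c = M' l r c) : hatF N P M w = hatF N P M' w := by
  have hu : ∀ l, IsUnit (M l).det := fun l => (hM l).isUnit
  have hu' : ∀ l, IsUnit (M' l).det := fun l => (hM' l).isUnit
  have key := he (fun l => M l * (M' l)⁻¹) (fun l => (M l)⁻¹) w ?_ ?_
  · have h1 : (fun l => (M l)⁻¹ * (M l * (M' l)⁻¹)) = fun l => (M' l)⁻¹ := by
      funext l
      rw [← Matrix.mul_assoc, Matrix.nonsing_inv_mul _ (hu l), Matrix.one_mul]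
    rw [h1] at key
    unfold hatF
    rw [key, ← mul_assoc, ← Finset.prod_mul_distrib]
    congr 1
    apply Finset.prod_congr rfl
    intro l _
    rw [← mul_pow, Matrix.det_mul, Matrix.det_nonsing_inv, Ring.inverse_eq_inv']
    congr 1
    field_simp [hM' l]
  · intro l
    rw [Matrix.det_mul, Matrix.det_nonsing_inv, Ring.inverse_eq_inv']
    exact mul_ne_zero (hM l) (inv_ne_zero (hM' l))
  · intro l r c hS
    rw [← Matrix.mul_nonsing_inv _ (hu' l), Matrix.mul_apply, Matrix.mul_apply]
    exact Finset.sum_congr rfl fun j _ => by rw [h l r j hS]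

/-- exponents -/
def expo (S : L → ι → Bool) (N : L → ℕ) (l : L) : ℕ :=
  (Finset.univ.filter fun r => S l r = false).card * N l

/-- cleared numerator -/
noncomputable def numP (N : L → ℕ) (P : MvPolynomial ((L × ι × ι) ⊕ τ) ℂ) :
    MvPolynomial ((L × ι × ι) ⊕ τ) ℂ :=
  (∏ l, detP l ^ N l) * bind₁ (pt (fun l => (mat X l).adjugate) (fun t => X (Sum.inr t))) P

/-- cleared denominator -/
noncomputable def denP (S : L → ι → Bool) (N : L → ℕ) : MvPolynomial ((L × ι × ι) ⊕ τ) ℂ :=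
  ∏ l, detP l ^ expo S N l

lemma eval_numP (N : L → ℕ) (P : MvPolynomial ((L × ι × ι) ⊕ τ) ℂ)
    (M : L → Matrix ι ι ℂ) (w : τ → ℂ) :
    eval (pt M w) (numP N P) =
      (∏ l, (M l).det ^ N l) * eval (pt (fun l => (M l).adjugate) w) P := by
  unfold numP
  rw [map_mul, map_prod]
  simp only [map_pow, eval_detP, mat_pt]
  congr 1
  rw [← coe_aeval_eq_eval, ← coe_aeval_eq_eval]
  simp only [RingHom.coe_coe, aeval_bind₁]
  congr 2
  funext i
  rcases i with ⟨l, r, c⟩ | t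
  · have h1 := congrFun (congrFun (RingHom.map_adjugate (eval (pt M w)) (mat X l)) r) c
    have h2 : (eval (pt M w)).mapMatrix (mat X l) = M l := by
      ext r c
      simp [mat, pt]
    rw [h2] at h1
    exact h1
  · simp [pt]

lemma numP_eq {S : L → ι → Bool} {N : L → ℕ} {P : MvPolynomial ((L × ι × ι) ⊕ τ) ℂ}
    (hi : DepC S P) (he : EqvR S N P) {M : L → Matrix ι ι ℂ} (w : τ → ℂ)
    (hM : ∀ l, (M l).det ≠ 0) :
    eval (pt M w) (numP N P) = eval (pt M w) (denP S N) * hatF N P M w := by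
  have hu : ∀ l, IsUnit (M l).det := fun l => (hM l).isUnit
  rw [eval_numP, hatF]
  let h : L → Matrix ι ι ℂ := fun l => Matrix.diagonal fun r => if S l r then 1 else (M l).det
  have hdet : ∀ l, (h l).det = (M l).det ^ (Finset.univ.filter fun r => S l r = false).card := by
    intro l
    simp only [h, Matrix.det_diagonal]
    rw [Finset.prod_ite, Finset.prod_const_one, Finset.prod_const, one_mul]
    simp
  have key := he h (fun l => (M l)⁻¹) w ?_ ?_
  · have h1 : eval (pt (fun l => (M l).adjugate) w) P = eval (pt (fun l => (M l)⁻¹ * h l) w) P := by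
      apply hi
      intro l r c hS
      simp only [h, Matrix.mul_diagonal, hS]
      rw [Matrix.inv_def, Ring.inverse_eq_inv', Matrix.smul_apply, smul_eq_mul]
      have := hM l
      simp
      field_simp
    rw [h1, key]
    simp only [denP, map_prod, map_pow, eval_detP, mat_pt, expo, hdet, ← pow_mul]
    ring
  · intro l
    rw [hdet]
    exact pow_ne_zero _ (hM l)
  · intro l r c hS
    simp [h, Matrix.diagonal_apply, Matrix.one_apply, hS]

lemma relPrime_den (S : L → ι → Bool) (N : L → ℕ) :
    IsRelPrime (rename Sum.inr (denP S N : MvPolynomial ((L × ι × ι) ⊕ τ) ℂ))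
      (bind₁ (glueP S) (denP S N)) := by
  unfold denP
  rw [map_prod, map_prod]
  apply IsRelPrime.prod_left
  intro l _
  apply IsRelPrime.prod_right
  intro l' _
  rw [map_pow, map_pow]
  by_cases hk : ∃ k0, S l k0 = false
  · obtain ⟨k0, hk⟩ := hk
    exact (relPrime S l l' k0 hk).pow
  · have : expo S N l = 0 := by
      unfold expo
      rw [Finset.filter_eq_empty_iff.2 (fun r _ h => hk ⟨r, h⟩)]
      simp
    rw [this, pow_zero]
    exact isRelPrime_one_left

/-- common nonvanishing polynomial -/
noncomputable def bigD (S : L → ι → Bool) : MvPolynomial ((L × ι × ι) ⊕ ((L × ι × ι) ⊕ τ)) ℂ :=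
  (∏ l, rename Sum.inr (detP l)) * ∏ l, bind₁ (glueP S) (detP l)

lemma bigD_ne_zero (S : L → ι → Bool) :
    (bigD S : MvPolynomial ((L × ι × ι) ⊕ ((L × ι × ι) ⊕ τ)) ℂ) ≠ 0 := by
  apply mul_ne_zero
  · rw [Finset.prod_ne_zero_iff]
    intro l _
    rw [Ne, map_eq_zero_iff _ (rename_injective _ Sum.inr_injective)]
    exact detP_ne_zero l
  · rw [Finset.prod_ne_zero_iff]
    intro l _
    exact det_glueP_ne_zero S l

lemma big_density {S : L → ι → Bool} {P Q : MvPolynomial ((L × ι × ι) ⊕ ((L × ι × ι) ⊕ τ)) ℂ}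
    (h : ∀ (T : L × ι × ι → ℂ) (x : (L × ι × ι) ⊕ τ → ℂ),
      (∀ l, (mat x l).det ≠ 0) → (∀ l, (mat (glue S T x) l).det ≠ 0) →
      eval (Sum.elim T x) P = eval (Sum.elim T x) Q) : P = Q := by
  apply density (bigD_ne_zero S)
  intro y hy
  have hy2 : y = Sum.elim (y ∘ Sum.inl) (y ∘ Sum.inr) := by simp
  rw [hy2]
  rw [bigD, map_mul, map_prod, map_prod] at hy
  have h1 := left_ne_zero_of_mul hy
  have h2 := right_ne_zero_of_mul hy
  rw [Finset.prod_ne_zero_iff] at h1 h2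
  apply h
  · intro l
    have := h1 l (Finset.mem_univ _)
    rwa [eval_ren, eval_detP] at this
  · intro l
    have := h2 l (Finset.mem_univ _)
    rwa [eval_glueP, eval_detP] at this

theorem reflA {S : L → ι → Bool} {N : L → ℕ} {P : MvPolynomial ((L × ι × ι) ⊕ τ) ℂ}
    (hi : DepC S P) (he : EqvR S N P) :
    ∃ Q : MvPolynomial ((L × ι × ι) ⊕ τ) ℂ, DepR S Q ∧
      ∀ M w, (∀ l, (M l).det ≠ 0) → eval (pt M w) Q = hatF N P M w := by
  have hdne : ∀ x : (L × ι × ι) ⊕ τ → ℂ, (∀ l, (mat x l).det ≠ 0) → eval x (denP S N) ≠ 0 := by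
    intro x hx
    rw [denP, map_prod, Finset.prod_ne_zero_iff]
    intro l _
    rw [map_pow, eval_detP]
    exact pow_ne_zero _ (hx l)
  have hnum : ∀ x : (L × ι × ι) ⊕ τ → ℂ, (∀ l, (mat x l).det ≠ 0) →
      eval x (numP N P) = eval x (denP S N) * hatF N P (mat x) (x ∘ Sum.inr) := by
    intro x hx
    have := numP_eq hi he (x ∘ Sum.inr) hx
    rwa [pt_mat] at this
  have hglue : ∀ (T : L × ι × ι → ℂ) (x : (L × ι × ι) ⊕ τ → ℂ),
      (∀ l, (mat x l).det ≠ 0) → (∀ l, (mat (glue S T x) l).det ≠ 0) →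
      hatF N P (mat (glue S T x)) (x ∘ Sum.inr) = hatF N P (mat x) (x ∘ Sum.inr) := by
    intro T x h1 h2
    apply hatF_congr he _ h2 h1
    intro l r c hS
    simp [mat, glue, hS]
  have hgw : ∀ (T : L × ι × ι → ℂ) (x : (L × ι × ι) ⊕ τ → ℂ),
    glue S T x ∘ Sum.inr = x ∘ Sum.inr := fun T x => rfl
  have e1 : rename Sum.inr (numP N P) * bind₁ (glueP S) (denP S N) =
      bind₁ (glueP S) (numP N P) * rename Sum.inr (denP S N) := by
    apply big_density (S := S)
    intro T x h1 h2
    simp only [map_mul, eval_ren, eval_glueP, Sum.elim_comp_inl, Sum.elim_comp_inr]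
    rw [hnum x h1, hnum _ h2, hgw, hglue T x h1 h2]
    ring
  have e2 : rename Sum.inr (denP S N) ∣ rename Sum.inr (numP N P) :=
    (relPrime_den S N).dvd_of_dvd_mul_right (e1 ▸ dvd_mul_left _ _)
  obtain ⟨Q1, hQ1⟩ := e2
  let Q : MvPolynomial ((L × ι × ι) ⊕ τ) ℂ := bind₁ (Sum.elim (fun _ => 0) X) Q1
  have hQ : ∀ x, eval x Q = eval (Sum.elim (fun _ => 0) x) Q1 := by
    intro x
    simp only [Q]
    rw [← coe_aeval_eq_eval, ← coe_aeval_eq_eval]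
    simp only [RingHom.coe_coe, aeval_bind₁]
    congr 2
    funext i
    rcases i with i | i <;> simp
  have hQ2 : ∀ x, (∀ l, (mat x l).det ≠ 0) → eval x Q = hatF N P (mat x) (x ∘ Sum.inr) := by
    intro x hx
    have := congrArg (eval (Sum.elim (fun _ => 0) x)) hQ1
    rw [map_mul, eval_ren, eval_ren, ← hQ, Sum.elim_comp_inr, hnum x hx] at this
    exact (mul_left_cancel₀ (hdne x hx) this).symm
  have e3 : bind₁ (glueP S) Q = rename Sum.inr Q := by
    apply big_density (S := S)
    intro T x h1 h2
    simp only [eval_ren, eval_glueP, Sum.elim_comp_inl, Sum.elim_comp_inr]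
    rw [hQ2 x h1, hQ2 _ h2, hgw, hglue T x h1 h2]
  refine ⟨Q, ?_, ?_⟩
  · intro M M' w h
    have := congrArg (eval (Sum.elim (fun i => M' i.1 i.2.1 i.2.2) (pt M w))) e3
    simp only [eval_ren, eval_glueP, Sum.elim_comp_inl, Sum.elim_comp_inr] at this
    rw [← this]
    congr 2
    funext i
    rcases i with ⟨l, r, c⟩ | t
    · simp only [glue, pt, Sum.elim_inl]
      split_ifs with hS
      · exact h l r c hS
      · rfl
    · rfl
  · intro M w hM
    exact hQ2 (pt M w) hM

/-- Left version of equivariance. -/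
def EqvL (S : L → ι → Bool) (N : L → ℕ) (P : MvPolynomial ((L × ι × ι) ⊕ τ) ℂ) : Prop :=
  ∀ (h X : L → Matrix ι ι ℂ) (w : τ → ℂ), (∀ l, (h l).det ≠ 0) →
    (∀ l r c, S l c = false → h l r c = (1 : Matrix ι ι ℂ) r c) →
    eval (pt (fun l => h l * X l) w) P = (∏ l, (h l).det ^ N l) * eval (pt X w) P

theorem reflB {S : L → ι → Bool} {N : L → ℕ} {P : MvPolynomial ((L × ι × ι) ⊕ τ) ℂ}
    (hi : DepR S P) (he : EqvL S N P) :
    ∃ Q : MvPolynomial ((L × ι × ι) ⊕ τ) ℂ, DepC S Q ∧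
      ∀ M w, (∀ l, (M l).det ≠ 0) → eval (pt M w) P = hatF N Q M w := by
  let tr : (L × ι × ι) ⊕ τ → (L × ι × ι) ⊕ τ :=
    Sum.map (fun i => (i.1, i.2.2, i.2.1)) id
  have htr : ∀ (P : MvPolynomial ((L × ι × ι) ⊕ τ) ℂ) (M : L → Matrix ι ι ℂ) (w : τ → ℂ),
      eval (pt M w) (rename tr P) = eval (pt (fun l => (M l).transpose) w) P := by
    intro P M w
    rw [eval_rename]
    congr 2
    funext i
    rcases i with i | t <;> rfl
  have hA : DepC (fun l r => !(S l r)) (rename tr P) := by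
    intro X X' w h
    rw [htr, htr]
    apply hi
    intro l r c hS
    exact h l c r (by simpa using hS)
  have hB : EqvR (fun l r => !(S l r)) N (rename tr P) := by
    intro h X w hd hS
    rw [htr, htr]
    have := he (fun l => (h l).transpose) (fun l => (X l).transpose) w (by simpa using hd) (by
      intro l r c h1
      rw [Matrix.transpose_apply, hS l c r (by simpa using h1), Matrix.one_apply, Matrix.one_apply]
      simp [eq_comm])
    simpa only [Matrix.transpose_mul, Matrix.det_transpose] using this
  obtain ⟨Q, hQ1, hQ2⟩ := reflA hA hB
  · refine ⟨rename tr Q, ?_, ?_⟩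
    · intro X X' w h
      rw [htr, htr]
      apply hQ1
      intro l r c hS
      exact h l c r (by simpa using hS)
    · intro M w hM
      have hu : ∀ l, IsUnit (M l).det := fun l => (hM l).isUnit
      have := hQ2 (fun l => (M l)⁻¹.transpose) w (by
        intro l
        rw [Matrix.det_transpose, Matrix.det_nonsing_inv, Ring.inverse_eq_inv']
        exact inv_ne_zero (hM l))
      rw [hatF, htr, this, hatF, htr]
      have h1 : (fun l => ((((M l)⁻¹).transpose)⁻¹).transpose) = M := by
        funext l
        rw [Matrix.transpose_nonsing_inv, Matrix.transpose_transpose,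
          Matrix.nonsing_inv_nonsing_inv _ (hu l)]
      rw [h1, ← mul_assoc, ← Finset.prod_mul_distrib, Finset.prod_eq_one, one_mul]
      intro l _
      rw [← mul_pow, Matrix.det_transpose, Matrix.det_nonsing_inv, Ring.inverse_eq_inv',
        mul_inv_cancel₀ (hM l), one_pow]

/-- density for points with invertible matrices -/
lemma pt_density {P Q : MvPolynomial ((L × ι × ι) ⊕ τ) ℂ}
    (h : ∀ M w, (∀ l, (M l).det ≠ 0) → eval (pt M w) P = eval (pt M w) Q) : P = Q := by
  apply density (D := ∏ l, detP l)
  · rw [Finset.prod_ne_zero_iff]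
    intro l _
    exact detP_ne_zero l
  · intro x hx
    rw [map_prod, Finset.prod_ne_zero_iff] at hx
    rw [← pt_mat x]
    apply h
    intro l
    rw [← eval_detP]
    exact hx l (Finset.mem_univ _)

end Refl
namespace Refl
open MvPolynomial
set_option linter.unusedSectionVars false

lemma eval_bind {σ τ : Type} (x : τ → ℂ) (θ : σ → MvPolynomial τ ℂ) (Q : MvPolynomial σ ℂ) :
    eval x (bind₁ θ Q) = eval (fun i => eval x (θ i)) Q := by
  rw [← coe_aeval_eq_eval, ← coe_aeval_eq_eval]
  simp only [RingHom.coe_coe, aeval_bind₁]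

lemma eval_opt {σ τ : Type} (o : σ → Option τ) (Q : MvPolynomial σ ℂ) :
    ∃ P : MvPolynomial τ ℂ, ∀ x : τ → ℂ, eval (fun i => (o i).elim 0 x) Q = eval x P := by
  refine ⟨bind₁ (fun i => (o i).elim 0 X) Q, fun x => ?_⟩
  rw [eval_bind]
  refine congrArg (fun x => eval x Q) ?_
  funext i
  cases o i <;> simp

section mats
variable {ι α β : Type} [Fintype ι] [DecidableEq ι] [Fintype α] [DecidableEq α]
  [Fintype β] [DecidableEq β] (e : ι ≃ α ⊕ β)

/-- The columns indexed by `β`. -/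
def colK {κ : Type} (M : Matrix κ ι ℂ) : Matrix κ β ℂ := M.submatrix id (e.symm ∘ Sum.inr)
/-- The rows indexed by `α`. -/
def rowL {κ : Type} (M : Matrix ι κ ℂ) : Matrix α κ ℂ := M.submatrix (e.symm ∘ Sum.inl) id
/-- Lower block triangular matrices. -/
def lowT (A : Matrix α α ℂ) (C : Matrix β α ℂ) (D : Matrix β β ℂ) : Matrix ι ι ℂ :=
  (Matrix.fromBlocks A 0 C D).submatrix e e

lemma det_lowT (A : Matrix α α ℂ) (C : Matrix β α ℂ) (D : Matrix β β ℂ) :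
    (lowT e A C D).det = A.det * D.det := by
  rw [lowT, Matrix.det_submatrix_equiv_self, Matrix.det_fromBlocks_zero₁₂]

lemma colK_mul_left (B X : Matrix ι ι ℂ) : colK e (B * X) = B * colK e X := by
  ext i j
  simp [colK, Matrix.mul_apply]

lemma rowL_mul_right (X B : Matrix ι ι ℂ) : rowL e (X * B) = rowL e X * B := by
  ext i j
  simp [rowL, Matrix.mul_apply]

lemma colK_mul_lowT (X : Matrix ι ι ℂ) (A : Matrix α α ℂ) (C : Matrix β α ℂ) (D : Matrix β β ℂ) :
    colK e (X * lowT e A C D) = colK e X * D := by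
  ext i j
  simp only [colK, Matrix.submatrix_apply, Matrix.mul_apply, Function.comp, lowT, id]
  rw [← Equiv.sum_comp e.symm, Fintype.sum_sum_type]
  simp

lemma rowL_lowT_mul (X : Matrix ι ι ℂ) (A : Matrix α α ℂ) (C : Matrix β α ℂ) (D : Matrix β β ℂ) :
    rowL e (lowT e A C D * X) = A * rowL e X := by
  ext i j
  simp only [rowL, Matrix.submatrix_apply, Matrix.mul_apply, Function.comp, lowT, id]
  rw [← Equiv.sum_comp e.symm, Fintype.sum_sum_type]
  simp

lemma lowT_mul_lowT (A A' : Matrix α α ℂ) (D D' : Matrix β β ℂ) :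
    lowT e A 0 D * lowT e A' 0 D' = lowT e (A * A') 0 (D * D') := by
  simp [lowT, Matrix.submatrix_mul_equiv, Matrix.fromBlocks_multiply]

lemma lowT_one : lowT e 1 0 1 = 1 := by
  simp [lowT]

lemma eq_lowT_of_rows (h : Matrix ι ι ℂ)
    (hh : ∀ r c, (e r).isLeft = true → h r c = (1 : Matrix ι ι ℂ) r c) :
    ∃ C D, h = lowT e 1 C D := by
  refine ⟨h.submatrix (e.symm ∘ Sum.inr) (e.symm ∘ Sum.inl),
    h.submatrix (e.symm ∘ Sum.inr) (e.symm ∘ Sum.inr), ?_⟩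
  ext r c
  obtain ⟨r, rfl⟩ := e.symm.surjective r
  obtain ⟨c, rfl⟩ := e.symm.surjective c
  rcases r with r | r
  · rw [hh _ _ (by simp)]
    rcases c with c | c <;> simp [lowT, Matrix.one_apply]
  · rcases c with c | c <;> simp [lowT]

lemma eq_lowT_of_cols (h : Matrix ι ι ℂ)
    (hh : ∀ r c, (e c).isLeft = false → h r c = (1 : Matrix ι ι ℂ) r c) :
    ∃ C A, h = lowT e A C 1 := by
  refine ⟨h.submatrix (e.symm ∘ Sum.inr) (e.symm ∘ Sum.inl),
    h.submatrix (e.symm ∘ Sum.inl) (e.symm ∘ Sum.inl), ?_⟩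
  ext r c
  obtain ⟨r, rfl⟩ := e.symm.surjective r
  obtain ⟨c, rfl⟩ := e.symm.surjective c
  rcases c with c | c
  · rcases r with r | r <;> simp [lowT]
  · rw [hh _ _ (by simp)]
    rcases r with r | r <;> simp [lowT, Matrix.one_apply]

end mats

section quiv
variable {m p n : ℕ}

/-- dimension vector -/
def dimV (k : Fin (m + p) → ℕ) (d : ℕ) (q : Fin n → ℕ) : SVert m p n → ℕ
  | .x l => k l
  | .z0 => d
  | .y j => q j

/-- weight -/
def wtV (s : Fin (m + p) → ℤ) (z : ℤ) (t : Fin n → ℤ) : SVert m p n → ℤ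
  | .x l => s l
  | .z0 => z
  | .y j => t j

/-- vertices as a sum type -/
def vEquiv : (Fin (m + p) ⊕ Unit) ⊕ Fin n ≃ SVert m p n where
  toFun
    | .inl (.inl l) => .x l
    | .inl (.inr _) => .z0
    | .inr j => .y j
  invFun
    | .x l => .inl (.inl l)
    | .z0 => .inl (.inr ())
    | .y j => .inr j
  left_inv := by rintro ((l | _) | j) <;> rfl
  right_inv := by rintro (l | _ | j) <;> rfl

lemma prod_SVert (f : SVert m p n → ℂ) :
    ∏ v, f v = (∏ l, f (.x l)) * f .z0 * ∏ j, f (.y j) := by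
  rw [← Equiv.prod_comp vEquiv, Fintype.prod_sum_type, Fintype.prod_sum_type]
  simp [vEquiv]

/-- index of the sink variables -/
abbrev Tau (n d : ℕ) (q : Fin n → ℕ) : Type := (j : Fin n) × (Fin (q j) × Fin d)

variable (k k' : Fin (m + p) → ℕ) (d : ℕ) (q : Fin n → ℕ)

abbrev GLn (r : ℕ) := (Matrix (Fin r) (Fin r) ℂ)ˣ

/-- group element of the first quiver -/
def mkG (A : ∀ l, GLn (k l)) (B : GLn d) (C : ∀ j, GLn (q j)) :
    ∀ v : SVert m p n, GLn (dimV k d q v)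
  | .x l => A l
  | .z0 => B
  | .y j => C j

/-- the weight value -/
noncomputable def wtval {k : Fin (m + p) → ℕ} {d : ℕ} {q : Fin n → ℕ}
    (s : Fin (m + p) → ℤ) (z : ℤ) (t : Fin n → ℤ)
    (A : ∀ l, GLn (k l)) (B : GLn d) (C : ∀ j, GLn (q j)) : ℂ :=
  (∏ l, (A l).val.det ^ s l) * B.val.det ^ z * ∏ j, (C j).val.det ^ t j

/-- representation from components -/
def mkS (X : ∀ l, Matrix (Fin d) (Fin (k l)) ℂ) (w : ∀ j, Matrix (Fin (q j)) (Fin d) ℂ) :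
    (Squiv m p n).Rep (dimV k d q)
  | .inl l => X l
  | .inr j => w j

/-- representation from components -/
def mkT (X : ∀ l, Matrix (Fin (k' l)) (Fin d) ℂ) (w : ∀ j, Matrix (Fin (q j)) (Fin d) ℂ) :
    (StildeQuiv m p n).Rep (dimV k' d q)
  | .inl l => X l
  | .inr j => w j

lemma mem_S (s : Fin (m + p) → ℤ) (z : ℤ) (t : Fin n → ℤ)
    (f : (Squiv m p n).Rep (dimV k d q) → ℂ) :
    f ∈ (Squiv m p n).SIw (dimV k d q) (wtV s z t) ↔ (Squiv m p n).IsPolyFun f ∧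
      ∀ (A : ∀ l, GLn (k l)) (B : GLn d) (C : ∀ j, GLn (q j)) X w,
        f (mkS k d q (fun l => (B⁻¹).val * X l * (A l).val)
          (fun j => ((C j)⁻¹).val * w j * B.val)) = wtval s z t A B C * f (mkS k d q X w) := by
  refine and_congr Iff.rfl ?_
  constructor
  · intro h A B C X w
    have := h (mkG k d q A B C) (mkS k d q X w)
    have h1 : (Squiv m p n).detWeight (wtV s z t) (mkG k d q A B C) = wtval s z t A B C :=
      prod_SVert _
    rw [h1] at this
    rw [← this]
    congr 1
    funext a
    rcases a with l | j <;> rfl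
  · intro h g W
    have := h (fun l => g (.x l)) (g .z0) (fun j => g (.y j)) (fun l => W (.inl l))
      (fun j => W (.inr j))
    have h1 : (Squiv m p n).detWeight (wtV s z t) g = wtval s z t (fun l => g (.x l)) (g .z0)
      (fun j => g (.y j)) := prod_SVert _
    have h2 : mkS k d q (fun l => W (.inl l)) (fun j => W (.inr j)) = W := by
      funext a
      rcases a with l | j <;> rfl
    rw [h2] at this
    rw [h1]
    refine Eq.trans (congrArg f ?_) this
    funext a
    rcases a with l | j <;> rfl

lemma mem_T (s : Fin (m + p) → ℤ) (z : ℤ) (t : Fin n → ℤ)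
    (f : (StildeQuiv m p n).Rep (dimV k' d q) → ℂ) :
    f ∈ (StildeQuiv m p n).SIw (dimV k' d q) (wtV s z t) ↔ (StildeQuiv m p n).IsPolyFun f ∧
      ∀ (A : ∀ l, GLn (k' l)) (B : GLn d) (C : ∀ j, GLn (q j)) X w,
        f (mkT k' d q (fun l => ((A l)⁻¹).val * X l * B.val)
          (fun j => ((C j)⁻¹).val * w j * B.val)) = wtval s z t A B C * f (mkT k' d q X w) := by
  refine and_congr Iff.rfl ?_
  constructor
  · intro h A B C X w
    have := h (mkG k' d q A B C) (mkT k' d q X w)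
    have h1 : (StildeQuiv m p n).detWeight (wtV s z t) (mkG k' d q A B C) = wtval s z t A B C :=
      prod_SVert _
    rw [h1] at this
    rw [← this]
    congr 1
    funext a
    rcases a with l | j <;> rfl
  · intro h g W
    have := h (fun l => g (.x l)) (g .z0) (fun j => g (.y j)) (fun l => W (.inl l))
      (fun j => W (.inr j))
    have h1 : (StildeQuiv m p n).detWeight (wtV s z t) g = wtval s z t (fun l => g (.x l)) (g .z0)
      (fun j => g (.y j)) := prod_SVert _
    have h2 : mkT k' d q (fun l => W (.inl l)) (fun j => W (.inr j)) = W := by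
      funext a
      rcases a with l | j <;> rfl
    rw [h2] at this
    rw [h1]
    refine Eq.trans (congrArg f ?_) this
    funext a
    rcases a with l | j <;> rfl

/-- matrices of sink variables -/
def wm {n d : ℕ} {q : Fin n → ℕ} (w : Tau n d q → ℂ) (j : Fin n) : Matrix (Fin (q j)) (Fin d) ℂ :=
  Matrix.of fun r c => w ⟨j, (r, c)⟩

/-- sink variables of matrices -/
def mw {n d : ℕ} {q : Fin n → ℕ} (w : ∀ j, Matrix (Fin (q j)) (Fin d) ℂ) : Tau n d q → ℂ :=
  fun t => w t.1 t.2.1 t.2.2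

lemma wm_mw {n d : ℕ} {q : Fin n → ℕ} (w : ∀ j, Matrix (Fin (q j)) (Fin d) ℂ) : wm (mw w) = w := rfl

variable {k k'} (e : ∀ l, Fin d ≃ Fin (k' l) ⊕ Fin (k l))

/-- point to representation -/
def toS (X : Fin (m + p) → Matrix (Fin d) (Fin d) ℂ) (w : Tau n d q → ℂ) :
    (Squiv m p n).Rep (dimV k d q) := mkS k d q (fun l => colK (e l) (X l)) (wm w)

/-- point to representation -/
def toT (X : Fin (m + p) → Matrix (Fin d) (Fin d) ℂ) (w : Tau n d q → ℂ) :
    (StildeQuiv m p n).Rep (dimV k' d q) := mkT k' d q (fun l => rowL (e l) (X l)) (wm w)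

lemma polyS {f : (Squiv m p n).Rep (dimV k d q) → ℂ} (hf : (Squiv m p n).IsPolyFun f) :
    ∃ P : MvPolynomial ((Fin (m + p) × Fin d × Fin d) ⊕ Tau n d q) ℂ,
      ∀ X w, f (toS d q e X w) = eval (pt X w) P := by
  obtain ⟨P, hP⟩ := hf
  let ρ : ((a : (Squiv m p n).A) × (Fin (dimV k d q ((Squiv m p n).h a)) ×
    Fin (dimV k d q ((Squiv m p n).t a)))) → (Fin (m + p) × Fin d × Fin d) ⊕ Tau n d q
    | ⟨.inl l, rc⟩ => .inl (l, rc.1, (e l).symm (.inr rc.2))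
    | ⟨.inr j, rc⟩ => .inr ⟨j, rc⟩
  refine ⟨rename ρ P, fun X w => ?_⟩
  rw [eval_rename, hP]
  congr 2
  funext i
  rcases i with ⟨l | j, rc⟩ <;> rfl

lemma polyT {f : (StildeQuiv m p n).Rep (dimV k' d q) → ℂ} (hf : (StildeQuiv m p n).IsPolyFun f) :
    ∃ P : MvPolynomial ((Fin (m + p) × Fin d × Fin d) ⊕ Tau n d q) ℂ,
      ∀ X w, f (toT d q e X w) = eval (pt X w) P := by
  obtain ⟨P, hP⟩ := hf
  let ρ : ((a : (StildeQuiv m p n).A) × (Fin (dimV k' d q ((StildeQuiv m p n).h a)) ×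
    Fin (dimV k' d q ((StildeQuiv m p n).t a)))) → (Fin (m + p) × Fin d × Fin d) ⊕ Tau n d q
    | ⟨.inl l, rc⟩ => .inl (l, (e l).symm (.inl rc.1), rc.2)
    | ⟨.inr j, rc⟩ => .inr ⟨j, rc⟩
  refine ⟨rename ρ P, fun X w => ?_⟩
  rw [eval_rename, hP]
  congr 2
  funext i
  rcases i with ⟨l | j, rc⟩ <;> rfl

/-- extension by zero -/
def extS (X : ∀ l, Matrix (Fin d) (Fin (k l)) ℂ) (l : Fin (m + p)) : Matrix (Fin d) (Fin d) ℂ :=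
  Matrix.of fun r c => Sum.elim (fun _ => 0) (fun c' => X l r c') (e l c)

/-- extension by zero -/
def extT (X : ∀ l, Matrix (Fin (k' l)) (Fin d) ℂ) (l : Fin (m + p)) : Matrix (Fin d) (Fin d) ℂ :=
  Matrix.of fun r c => Sum.elim (fun r' => X l r' c) (fun _ => 0) (e l r)

lemma toS_ext (X : ∀ l, Matrix (Fin d) (Fin (k l)) ℂ) (w : ∀ j, Matrix (Fin (q j)) (Fin d) ℂ) :
    toS d q e (extS d e X) (mw w) = mkS k d q X w := by
  rw [toS, wm_mw]
  congr 1
  funext l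
  ext r c
  simp [colK, extS]

lemma toT_ext (X : ∀ l, Matrix (Fin (k' l)) (Fin d) ℂ) (w : ∀ j, Matrix (Fin (q j)) (Fin d) ℂ) :
    toT d q e (extT d e X) (mw w) = mkT k' d q X w := by
  rw [toT, wm_mw]
  congr 1
  funext l
  ext r c
  simp [rowL, extT]

lemma existsS (Q : MvPolynomial ((Fin (m + p) × Fin d × Fin d) ⊕ Tau n d q) ℂ)
    (hQ : DepC (fun l c => (e l c).isLeft) Q) :
    ∃ f : (Squiv m p n).Rep (dimV k d q) → ℂ, (Squiv m p n).IsPolyFun f ∧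
      ∀ X w, f (toS d q e X w) = eval (pt X w) Q := by
  obtain ⟨P, hP⟩ := eval_opt (τ := (a : (Squiv m p n).A) ×
      (Fin (dimV k d q ((Squiv m p n).h a)) × Fin (dimV k d q ((Squiv m p n).t a))))
    (fun i : (Fin (m + p) × Fin d × Fin d) ⊕ Tau n d q => match i with
      | .inl i => Sum.elim (fun _ => none) (fun c' => some ⟨.inl i.1, (i.2.1, c')⟩) (e i.1 i.2.2)
      | .inr t => some ⟨.inr t.1, t.2⟩) Q
  refine ⟨fun W => eval (pt (extS d e (fun l => W (.inl l))) (mw (fun j => W (.inr j)))) Q,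
    ⟨P, ?_⟩, ?_⟩
  · intro W
    refine Eq.trans ?_ (hP _)
    refine congrArg (fun x => eval x Q) ?_
    funext i
    rcases i with ⟨l, r, c⟩ | t
    · simp only [pt, Sum.elim_inl, extS, Matrix.of_apply]
      rcases e l c with c' | c' <;> rfl
    · rfl
  · intro X w
    apply hQ
    intro l r c hc
    simp only [extS, Matrix.of_apply]
    rcases h : e l c with c' | c'
    · simp [h] at hc
    · have h2 := (e l).symm_apply_apply c
      rw [h] at h2
      change X l r ((e l).symm (Sum.inr c')) = X l r c
      rw [h2]

lemma existsT (Q : MvPolynomial ((Fin (m + p) × Fin d × Fin d) ⊕ Tau n d q) ℂ)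
    (hQ : DepR (fun l c => (e l c).isLeft) Q) :
    ∃ f : (StildeQuiv m p n).Rep (dimV k' d q) → ℂ, (StildeQuiv m p n).IsPolyFun f ∧
      ∀ X w, f (toT d q e X w) = eval (pt X w) Q := by
  obtain ⟨P, hP⟩ := eval_opt (τ := (a : (StildeQuiv m p n).A) ×
      (Fin (dimV k' d q ((StildeQuiv m p n).h a)) × Fin (dimV k' d q ((StildeQuiv m p n).t a))))
    (fun i : (Fin (m + p) × Fin d × Fin d) ⊕ Tau n d q => match i with
      | .inl i => Sum.elim (fun r' => some ⟨.inl i.1, (r', i.2.2)⟩) (fun _ => none) (e i.1 i.2.1)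
      | .inr t => some ⟨.inr t.1, t.2⟩) Q
  refine ⟨fun W => eval (pt (extT d e (fun l => W (.inl l))) (mw (fun j => W (.inr j)))) Q,
    ⟨P, ?_⟩, ?_⟩
  · intro W
    refine Eq.trans ?_ (hP _)
    refine congrArg (fun x => eval x Q) ?_
    funext i
    rcases i with ⟨l, r, c⟩ | t
    · simp only [pt, Sum.elim_inl, extT, Matrix.of_apply]
      rcases e l r with c' | c' <;> rfl
    · rfl
  · intro X w
    apply hQ
    intro l r c hc
    simp only [extT, Matrix.of_apply]
    rcases h : e l r with c' | c'
    · have h2 := (e l).symm_apply_apply r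
      rw [h] at h2
      change X l ((e l).symm (Sum.inl c')) c = X l r c
      rw [h2]
    · simp [h] at hc

end quiv
end Refl
namespace Refl
open MvPolynomial
set_option linter.unusedSectionVars false

section gen
variable {m p n : ℕ} {k k' : Fin (m + p) → ℕ} (d : ℕ) (q : Fin n → ℕ)
  (e : ∀ l, Fin d ≃ Fin (k' l) ⊕ Fin (k l))

lemma polySubst (Q : MvPolynomial ((Fin (m + p) × Fin d × Fin d) ⊕ Tau n d q) ℂ)
    (U V : Fin (m + p) → Matrix (Fin d) (Fin d) ℂ) (C' : ∀ j, Matrix (Fin (q j)) (Fin (q j)) ℂ)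
    (B : Matrix (Fin d) (Fin d) ℂ) :
    ∃ Q' : MvPolynomial ((Fin (m + p) × Fin d × Fin d) ⊕ Tau n d q) ℂ, ∀ M w,
      eval (pt M w) Q' =
        eval (pt (fun l => U l * M l * V l) (mw fun j => C' j * wm w j * B)) Q := by
  let θ : (Fin (m + p) × Fin d × Fin d) ⊕ Tau n d q →
      MvPolynomial ((Fin (m + p) × Fin d × Fin d) ⊕ Tau n d q) ℂ
    | .inl i => ∑ b, (∑ a, C (U i.1 i.2.1 a) * X (.inl (i.1, a, b))) * C (V i.1 b i.2.2)
    | .inr t => ∑ b, (∑ a, C (C' t.1 t.2.1 a) * X (.inr ⟨t.1, (a, b)⟩)) * C (B b t.2.2)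
  refine ⟨bind₁ θ Q, fun M w => ?_⟩
  rw [eval_bind]
  refine congrArg (fun x => eval x Q) ?_
  funext i
  rcases i with ⟨l, r, c⟩ | ⟨j, r, c⟩
  · simp [θ, pt, Matrix.mul_apply]
  · simp [θ, pt, mw, wm, Matrix.mul_apply]

lemma mkT_act (X : Fin (m + p) → Matrix (Fin d) (Fin d) ℂ)
    (A : ∀ l, Matrix (Fin (k' l)) (Fin (k' l)) ℂ) (D : ∀ l, Matrix (Fin (k l)) (Fin (k l)) ℂ)
    (B : Matrix (Fin d) (Fin d) ℂ) (w : ∀ j, Matrix (Fin (q j)) (Fin d) ℂ) :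
    toT d q e (fun l => lowT (e l) (A l) 0 (D l) * X l * B) (mw w) =
      mkT k' d q (fun l => A l * rowL (e l) (X l) * B) w := by
  rw [toT, wm_mw]
  congr 1
  funext l
  rw [rowL_mul_right, rowL_lowT_mul]

lemma mkS_act (X : Fin (m + p) → Matrix (Fin d) (Fin d) ℂ)
    (A : ∀ l, Matrix (Fin (k' l)) (Fin (k' l)) ℂ) (D : ∀ l, Matrix (Fin (k l)) (Fin (k l)) ℂ)
    (B : Matrix (Fin d) (Fin d) ℂ) (w : ∀ j, Matrix (Fin (q j)) (Fin d) ℂ) :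
    toS d q e (fun l => B * X l * lowT (e l) (A l) 0 (D l)) (mw w) =
      mkS k d q (fun l => B * colK (e l) (X l) * D l) w := by
  rw [toS, wm_mw]
  congr 1
  funext l
  rw [colK_mul_lowT, colK_mul_left]

lemma det_inv_GLn {r : ℕ} (A : GLn r) : (A⁻¹).val.det = (A.val.det)⁻¹ := by
  apply eq_inv_of_mul_eq_one_left
  rw [← Matrix.det_mul, Units.inv_mul, Matrix.det_one]

lemma det_GLn_ne {r : ℕ} (A : GLn r) : A.val.det ≠ 0 := by
  intro h
  have : (A.val * (A⁻¹).val).det = 1 := by rw [Units.mul_inv, Matrix.det_one]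
  rw [Matrix.det_mul, h, zero_mul] at this
  exact zero_ne_one this

lemma rel_act (N : Fin (m + p) → ℕ)
    {fs : (Squiv m p n).Rep (dimV k d q) → ℂ} {ft : (StildeQuiv m p n).Rep (dimV k' d q) → ℂ}
    (hrel : ∀ g w, (∀ l, (g l).det ≠ 0) →
      ft (toT d q e g w) = (∏ l, (g l).det ^ N l) * fs (toS d q e (fun l => (g l)⁻¹) w))
    (A' : ∀ l, GLn (k' l)) (A : ∀ l, GLn (k l)) (B : GLn d)
    (g : Fin (m + p) → Matrix (Fin d) (Fin d) ℂ) (hg : ∀ l, (g l).det ≠ 0)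
    (w : ∀ j, Matrix (Fin (q j)) (Fin d) ℂ) :
    ft (mkT k' d q (fun l => ((A' l)⁻¹).val * rowL (e l) (g l) * B.val) w) =
      (∏ l, (A' l).val.det ^ (-(N l : ℤ))) * (∏ l, (A l).val.det ^ (-(N l : ℤ))) *
        B.val.det ^ (∑ l, (N l : ℤ)) * (∏ l, (g l).det ^ N l) *
        fs (mkS k d q (fun l => (B⁻¹).val * colK (e l) (g l)⁻¹ * (A l).val) w) := by
  have hdet : ∀ l, (lowT (e l) ((A' l)⁻¹).val 0 ((A l)⁻¹).val * g l * B.val).det =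
      (A' l).val.det⁻¹ * (A l).val.det⁻¹ * (g l).det * B.val.det := by
    intro l
    rw [Matrix.det_mul, Matrix.det_mul, det_lowT, det_inv_GLn, det_inv_GLn]
  have h := hrel (fun l => lowT (e l) ((A' l)⁻¹).val 0 ((A l)⁻¹).val * g l * B.val) (mw w) (by
    intro l
    rw [hdet]
    have := det_GLn_ne (A' l)
    have := det_GLn_ne (A l)
    have := det_GLn_ne B
    have := hg l
    positivity)
  have hinv : ∀ l, (lowT (e l) ((A' l)⁻¹).val 0 ((A l)⁻¹).val * g l * B.val)⁻¹ =
      (B⁻¹).val * (g l)⁻¹ * lowT (e l) (A' l).val 0 (A l).val := by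
    intro l
    apply Matrix.inv_eq_left_inv
    have h1 : lowT (e l) (A' l).val 0 (A l).val * lowT (e l) ((A' l)⁻¹).val 0 ((A l)⁻¹).val = 1 := by
      rw [lowT_mul_lowT, Units.mul_inv, Units.mul_inv, lowT_one]
    have h2 : (g l)⁻¹ * g l = 1 := Matrix.nonsing_inv_mul _ (IsUnit.mk0 _ (hg l))
    calc (B⁻¹).val * (g l)⁻¹ * lowT (e l) (A' l).val 0 (A l).val *
          (lowT (e l) ((A' l)⁻¹).val 0 ((A l)⁻¹).val * g l * B.val)
        = (B⁻¹).val * ((g l)⁻¹ * ((lowT (e l) (A' l).val 0 (A l).val *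
          lowT (e l) ((A' l)⁻¹).val 0 ((A l)⁻¹).val) * g l)) * B.val := by
          simp only [Matrix.mul_assoc]
      _ = 1 := by
          rw [h1, Matrix.one_mul, h2, Matrix.mul_one, Units.inv_mul]
  have e1 := mkT_act d q e g (fun l => ((A' l)⁻¹).val) (fun l => ((A l)⁻¹).val) B.val w
  have e2 := mkS_act d q e (fun l => (g l)⁻¹) (fun l => (A' l).val) (fun l => (A l).val)
    (B⁻¹).val w
  have e3 : (fun l => (lowT (e l) ((A' l)⁻¹).val 0 ((A l)⁻¹).val * g l * B.val)⁻¹) =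
      fun l => (B⁻¹).val * (g l)⁻¹ * lowT (e l) (A' l).val 0 (A l).val := funext hinv
  refine (congrArg ft e1.symm).trans (h.trans ?_)
  refine congrArg₂ (· * ·) ?_ (congrArg fs ((congrArg (fun X => toS d q e X (mw w)) e3).trans e2))
  rw [← Nat.cast_sum, zpow_natCast, ← Finset.prod_pow_eq_pow_sum, ← Finset.prod_mul_distrib, ← Finset.prod_mul_distrib,
    ← Finset.prod_mul_distrib]
  refine Finset.prod_congr rfl fun l _ => ?_
  rw [hdet, mul_pow, mul_pow, mul_pow]
  simp only [zpow_neg, zpow_natCast, inv_pow]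
  ring

/-- extension of an identity from invertible matrices -/
lemma ext_ident (Q : MvPolynomial ((Fin (m + p) × Fin d × Fin d) ⊕ Tau n d q) ℂ)
    (U V : Fin (m + p) → Matrix (Fin d) (Fin d) ℂ) (C' : ∀ j, Matrix (Fin (q j)) (Fin (q j)) ℂ)
    (B : Matrix (Fin d) (Fin d) ℂ) (c : ℂ)
    (h : ∀ M w, (∀ l, (M l).det ≠ 0) →
      eval (pt (fun l => U l * M l * V l) (mw fun j => C' j * wm w j * B)) Q =
        c * eval (pt M w) Q) (M : Fin (m + p) → Matrix (Fin d) (Fin d) ℂ) (w : Tau n d q → ℂ) :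
    eval (pt (fun l => U l * M l * V l) (mw fun j => C' j * wm w j * B)) Q =
        c * eval (pt M w) Q := by
  obtain ⟨Q', hQ'⟩ := polySubst d q Q U V C' B
  have : Q' = C c * Q := by
    apply pt_density
    intro M w hM
    rw [hQ', h M w hM]
    simp
  rw [← hQ', this]
  simp

lemma relT (N : Fin (m + p) → ℕ) (z : ℤ) (t : Fin n → ℤ)
    {fs : (Squiv m p n).Rep (dimV k d q) → ℂ} {ft : (StildeQuiv m p n).Rep (dimV k' d q) → ℂ}
    (hrel : ∀ g w, (∀ l, (g l).det ≠ 0) →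
      ft (toT d q e g w) = (∏ l, (g l).det ^ N l) * fs (toS d q e (fun l => (g l)⁻¹) w))
    (hs : fs ∈ (Squiv m p n).SIw (dimV k d q) (wtV (fun l => (N l : ℤ)) z t))
    (ht : (StildeQuiv m p n).IsPolyFun ft) :
    ft ∈ (StildeQuiv m p n).SIw (dimV k' d q)
      (wtV (fun l => -(N l : ℤ)) (z + ∑ l, (N l : ℤ)) t) := by
  rw [mem_S] at hs
  rw [mem_T]
  refine ⟨ht, fun A B C X w => ?_⟩
  obtain ⟨Q, hQ⟩ := polyT d q e ht
  have key := ext_ident d q Q (fun l => lowT (e l) ((A l)⁻¹).val 0 (1 : Matrix _ _ ℂ))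
    (fun _ => B.val) (fun j => ((C j)⁻¹).val) B.val
    (wtval (fun l => -(N l : ℤ)) (z + ∑ l, (N l : ℤ)) t A B C) (by
      intro g w hg
      rw [← hQ, ← hQ]
      refine (congrArg ft (mkT_act d q e g _ _ _ _)).trans ?_
      refine (rel_act d q e N hrel A 1 B g hg _).trans ?_
      have h1 := hs.2 1 B C (fun l => colK (e l) (g l)⁻¹) (wm w)
      have h2 := hrel g w hg
      refine (congrArg (fun x => _ * x) h1).trans ?_
      refine Eq.trans ?_ (congrArg (fun x => _ * x) h2).symm
      change _ * (_ * fs (toS d q e (fun l => (g l)⁻¹) w)) = _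
      simp only [wtval, Pi.one_apply, Units.val_one, Matrix.det_one, one_zpow,
        Finset.prod_const_one, zpow_add₀ (det_GLn_ne B)]
      ring) (extT d e X) (mw w)
  rw [← hQ, ← hQ] at key
  have h3 := (congrArg ft (mkT_act d q e (extT d e X) (fun l => ((A l)⁻¹).val) (fun _ => 1) B.val
    (fun j => ((C j)⁻¹).val * wm (mw w) j * B.val))).symm.trans key
  have h4 : (fun l => rowL (e l) (extT d e X l)) = X := by
    funext l
    ext r c
    simp [rowL, extT]
  refine Eq.trans (congrArg ft ?_) (h3.trans (congrArg (fun x => _ * ft x) (toT_ext d q e X w)))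
  conv_lhs => rw [← h4]
  rfl

lemma relS (N : Fin (m + p) → ℕ) (z : ℤ) (t : Fin n → ℤ)
    {fs : (Squiv m p n).Rep (dimV k d q) → ℂ} {ft : (StildeQuiv m p n).Rep (dimV k' d q) → ℂ}
    (hrel : ∀ g w, (∀ l, (g l).det ≠ 0) →
      ft (toT d q e g w) = (∏ l, (g l).det ^ N l) * fs (toS d q e (fun l => (g l)⁻¹) w))
    (hs : (Squiv m p n).IsPolyFun fs)
    (ht : ft ∈ (StildeQuiv m p n).SIw (dimV k' d q)
      (wtV (fun l => -(N l : ℤ)) (z + ∑ l, (N l : ℤ)) t)) :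
    fs ∈ (Squiv m p n).SIw (dimV k d q) (wtV (fun l => (N l : ℤ)) z t) := by
  rw [mem_T] at ht
  rw [mem_S]
  refine ⟨hs, fun A B C X w => ?_⟩
  obtain ⟨Q, hQ⟩ := polyS d q e hs
  have key := ext_ident d q Q (fun l => (B⁻¹).val)
    (fun l => lowT (e l) (1 : Matrix _ _ ℂ) 0 (A l).val) (fun j => ((C j)⁻¹).val) B.val
    (wtval (fun l => (N l : ℤ)) z t A B C) (by
      intro X w hX
      rw [← hQ, ← hQ]
      refine (congrArg fs (mkS_act d q e X _ _ _ _)).trans ?_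
      have hg : ∀ l, ((X l)⁻¹).det ≠ 0 := by
        intro l
        rw [Matrix.det_nonsing_inv, Ring.inverse_eq_inv']
        exact inv_ne_zero (hX l)
      have hii : (fun l => ((X l)⁻¹)⁻¹) = X := by
        funext l
        exact Matrix.nonsing_inv_nonsing_inv _ (IsUnit.mk0 _ (hX l))
      have h0 := rel_act d q e N hrel 1 A B (fun l => (X l)⁻¹) hg
        (fun j => ((C j)⁻¹).val * wm w j * B.val)
      have h1 := ht.2 1 B C (fun l => rowL (e l) (X l)⁻¹) (wm w)
      have h2 := hrel (fun l => (X l)⁻¹) w hg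
      have hii2 : (fun l => (B⁻¹).val * colK (e l) ((X l)⁻¹)⁻¹ * (A l).val) =
          (fun l => (B⁻¹).val * colK (e l) (X l) * (A l).val) := by
        funext l
        rw [congrFun hii l]
      have h5 := h0.symm.trans (h1.trans (congrArg (fun x => _ * x) h2))
      have h6 := (congrArg (fun x => _ * fs (mkS k d q x _)) hii2).symm.trans
        (h5.trans (congrArg (fun x => _ * (_ * fs (toS d q e x w))) hii))
      generalize fs (toS d q e X w) = u at h6 ⊢
      change _ * fs (mkS k d q (fun l => (B⁻¹).val * colK (e l) (X l) * (A l).val) _) = _ at h6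
      generalize fs (mkS k d q (fun l => (B⁻¹).val * colK (e l) (X l) * (A l).val) _) = v at h6 ⊢
      simp only [wtval, Pi.one_apply, Units.val_one, Matrix.det_one, one_zpow,
        Finset.prod_const_one, zpow_add₀ (det_GLn_ne B), zpow_neg, Finset.prod_inv_distrib] at h6 ⊢
      have n1 : (∏ l, (A l).val.det ^ (N l : ℤ)) ≠ 0 :=
        Finset.prod_ne_zero_iff.2 fun l _ => zpow_ne_zero _ (det_GLn_ne _)
      have n2 : (∏ l, ((X l)⁻¹).det ^ (N l)) ≠ 0 :=
        Finset.prod_ne_zero_iff.2 fun l _ => pow_ne_zero _ (hg l)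
      have n3 : B.val.det ^ (∑ l, (N l : ℤ)) ≠ 0 := zpow_ne_zero _ (det_GLn_ne B)
      generalize (∏ l, (A l).val.det ^ (N l : ℤ)) = a1 at *
      generalize (∏ l, ((X l)⁻¹).det ^ (N l)) = a2 at *
      generalize B.val.det ^ (∑ l, (N l : ℤ)) = a3 at *
      apply mul_left_cancel₀ (mul_ne_zero (mul_ne_zero (inv_ne_zero n1) n3) n2)
      have : a1⁻¹ * a1 = 1 := inv_mul_cancel₀ n1
      linear_combination h6 - (a3 * a2 * B.val.det ^ z * (∏ j, (C j).val.det ^ t j) * u) * this)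
      (extS d e X) (mw w)
  rw [← hQ, ← hQ] at key
  have h3 := (congrArg fs (mkS_act d q e (extS d e X) (fun _ => 1) (fun l => (A l).val) (B⁻¹).val
    (fun j => ((C j)⁻¹).val * wm (mw w) j * B.val))).symm.trans key
  have h4 : (fun l => colK (e l) (extS d e X l)) = X := by
    funext l
    ext r c
    simp [colK, extS]
  refine Eq.trans (congrArg fs ?_) (h3.trans (congrArg (fun x => _ * fs x) (toS_ext d q e X w)))
  conv_lhs => rw [← h4]
  rfl

end gen
end Refl
namespace Refl
open MvPolynomial
set_option linter.unusedSectionVars false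

section gen
variable {m p n : ℕ} {k k' : Fin (m + p) → ℕ} (d : ℕ) (q : Fin n → ℕ)
  (e : ∀ l, Fin d ≃ Fin (k' l) ⊕ Fin (k l))

lemma transA (N : Fin (m + p) → ℕ) (z : ℤ) (t : Fin n → ℤ)
    {fs : (Squiv m p n).Rep (dimV k d q) → ℂ}
    (hs : fs ∈ (Squiv m p n).SIw (dimV k d q) (wtV (fun l => (N l : ℤ)) z t)) :
    ∃ ft : (StildeQuiv m p n).Rep (dimV k' d q) → ℂ, (StildeQuiv m p n).IsPolyFun ft ∧
    ∀ g w, (∀ l, (g l).det ≠ 0) →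
      ft (toT d q e g w) = (∏ l, (g l).det ^ N l) * fs (toS d q e (fun l => (g l)⁻¹) w) := by
  rw [mem_S] at hs
  obtain ⟨P, hP⟩ := polyS d q e hs.1
  have hC : DepC (fun l c => (e l c).isLeft) P := by
    intro X X' w h
    rw [← hP, ← hP]
    have : (fun l => colK (e l) (X l)) = fun l => colK (e l) (X' l) := by
      funext l
      ext r c
      exact h l r _ (by simp)
    exact congrArg (fun x => fs (mkS k d q x (wm w))) this
  have hE : EqvR (fun l c => (e l c).isLeft) N P := by
    intro h X w hd hh
    rw [← hP, ← hP]
    choose C D hCD using fun l => eq_lowT_of_rows (e l) (h l) (hh l)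
    have hD : ∀ l, (h l).det = (D l).det := by
      intro l
      conv_lhs => rw [hCD l, det_lowT, Matrix.det_one, one_mul]
    have hDu : ∀ l, IsUnit (D l).det := fun l => IsUnit.mk0 _ (by rw [← hD]; exact hd l)
    have h1 := hs.2 (fun l => Matrix.nonsingInvUnit (D l) (hDu l)) 1 1
      (fun l => colK (e l) (X l)) (wm w)
    have h2 : wtval (fun l => (N l : ℤ)) z t (fun l => Matrix.nonsingInvUnit (D l) (hDu l))
        (1 : GLn d) (1 : ∀ j, GLn (q j)) = ∏ l, (h l).det ^ N l := by
      simp only [wtval, Pi.one_apply, Units.val_one, Matrix.det_one, one_zpow,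
        Finset.prod_const_one, mul_one, zpow_natCast]
      refine Finset.prod_congr rfl fun l _ => ?_
      rw [hD l]
      rfl
    rw [h2] at h1
    refine Eq.trans (congrArg fs ?_) h1
    refine congrArg₂ (mkS k d q) ?_ ?_
    · funext l
      refine (congrArg (fun Y => colK (e l) (X l * Y)) (hCD l)).trans ?_
      rw [colK_mul_lowT]
      simp [Matrix.nonsingInvUnit]
    · funext j
      simp
  obtain ⟨Q, hQ, hQ2⟩ := reflA hC hE
  obtain ⟨ft, h1, h2⟩ := existsT d q e Q hQ
  refine ⟨ft, h1, fun g w hg => ?_⟩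
  rw [h2, hQ2 g w hg, hP, hatF]

lemma transB (N : Fin (m + p) → ℕ) (z : ℤ) (t : Fin n → ℤ)
    {ft : (StildeQuiv m p n).Rep (dimV k' d q) → ℂ}
    (ht : ft ∈ (StildeQuiv m p n).SIw (dimV k' d q) (wtV (fun l => -(N l : ℤ)) z t)) :
    ∃ fs : (Squiv m p n).Rep (dimV k d q) → ℂ, (Squiv m p n).IsPolyFun fs ∧
    ∀ g w, (∀ l, (g l).det ≠ 0) →
      ft (toT d q e g w) = (∏ l, (g l).det ^ N l) * fs (toS d q e (fun l => (g l)⁻¹) w) := by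
  rw [mem_T] at ht
  obtain ⟨P, hP⟩ := polyT d q e ht.1
  have hC : DepR (fun l c => (e l c).isLeft) P := by
    intro X X' w h
    rw [← hP, ← hP]
    have : (fun l => rowL (e l) (X l)) = fun l => rowL (e l) (X' l) := by
      funext l
      ext r c
      exact h l _ c (by simp)
    exact congrArg (fun x => ft (mkT k' d q x (wm w))) this
  have hE : EqvL (fun l c => (e l c).isLeft) N P := by
    intro h X w hd hh
    rw [← hP, ← hP]
    choose C D hCD using fun l => eq_lowT_of_cols (e l) (h l) (hh l)
    have hD : ∀ l, (h l).det = (D l).det := by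
      intro l
      conv_lhs => rw [hCD l, det_lowT, Matrix.det_one, mul_one]
    have hDu : ∀ l, IsUnit (D l).det := fun l => IsUnit.mk0 _ (by rw [← hD]; exact hd l)
    have h1 := ht.2 (fun l => (Matrix.nonsingInvUnit (D l) (hDu l))⁻¹) 1 1
      (fun l => rowL (e l) (X l)) (wm w)
    have h2 : wtval (fun l => -(N l : ℤ)) z t (fun l => (Matrix.nonsingInvUnit (D l) (hDu l))⁻¹)
        (1 : GLn d) (1 : ∀ j, GLn (q j)) = ∏ l, (h l).det ^ N l := by
      simp only [wtval, Pi.one_apply, Units.val_one, Matrix.det_one, one_zpow,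
        Finset.prod_const_one, mul_one]
      refine Finset.prod_congr rfl fun l _ => ?_
      rw [hD l, det_inv_GLn, inv_zpow', neg_neg, zpow_natCast]
      rfl
    rw [h2] at h1
    refine Eq.trans (congrArg ft ?_) h1
    refine congrArg₂ (mkT k' d q) ?_ ?_
    · funext l
      refine (congrArg (fun Y => rowL (e l) (Y * X l)) (hCD l)).trans ?_
      rw [rowL_lowT_mul]
      simp [Matrix.nonsingInvUnit]
    · funext j
      simp
  obtain ⟨Q, hQ, hQ2⟩ := reflB hC hE
  obtain ⟨fs, h1, h2⟩ := existsS d q e Q hQ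
  refine ⟨fs, h1, fun g w hg => ?_⟩
  rw [h2, hP, hQ2 g w hg, hatF]

lemma inj_T {f f' : (StildeQuiv m p n).Rep (dimV k' d q) → ℂ}
    (hf : (StildeQuiv m p n).IsPolyFun f) (hf' : (StildeQuiv m p n).IsPolyFun f')
    (h : ∀ g w, (∀ l, (g l).det ≠ 0) → f (toT d q e g w) = f' (toT d q e g w)) : f = f' := by
  obtain ⟨P, hP⟩ := polyT d q e hf
  obtain ⟨P', hP'⟩ := polyT d q e hf'
  have : P = P' := pt_density fun M w hM => by rw [← hP, ← hP', h M w hM]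
  funext W
  have h2 : toT d q e (extT d e (fun l => W (.inl l))) (mw (fun j => W (.inr j))) = W := by
    refine (toT_ext d q e _ _).trans ?_
    funext a
    rcases a with l | j <;> rfl
  rw [← h2, hP, hP', this]

lemma inj_S {f f' : (Squiv m p n).Rep (dimV k d q) → ℂ}
    (hf : (Squiv m p n).IsPolyFun f) (hf' : (Squiv m p n).IsPolyFun f')
    (h : ∀ g w, (∀ l, (g l).det ≠ 0) → f (toS d q e g w) = f' (toS d q e g w)) : f = f' := by
  obtain ⟨P, hP⟩ := polyS d q e hf
  obtain ⟨P', hP'⟩ := polyS d q e hf'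
  have : P = P' := pt_density fun M w hM => by rw [← hP, ← hP', h M w hM]
  funext W
  have h2 : toS d q e (extS d e (fun l => W (.inl l))) (mw (fun j => W (.inr j))) = W := by
    refine (toS_ext d q e _ _).trans ?_
    funext a
    rcases a with l | j <;> rfl
  rw [← h2, hP, hP', this]

/-- restriction to invertible matrices, first quiver -/
noncomputable def rhoS (N : Fin (m + p) → ℕ) (β) :
    (Squiv m p n).SIw (dimV k d q) β →ₗ[ℂ]
      ({g : Fin (m + p) → Matrix (Fin d) (Fin d) ℂ // ∀ l, (g l).det ≠ 0} × (Tau n d q → ℂ) → ℂ) where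
  toFun f x := (∏ l, (x.1.1 l).det ^ N l) * f.1 (toS d q e (fun l => (x.1.1 l)⁻¹) x.2)
  map_add' f f' := by
    funext x
    exact mul_add _ _ _
  map_smul' c f := by
    funext x
    exact mul_left_comm _ _ _

/-- restriction to invertible matrices, second quiver -/
noncomputable def rhoT (β) :
    (StildeQuiv m p n).SIw (dimV k' d q) β →ₗ[ℂ]
      ({g : Fin (m + p) → Matrix (Fin d) (Fin d) ℂ // ∀ l, (g l).det ≠ 0} × (Tau n d q → ℂ) → ℂ) where
  toFun f x := f.1 (toT d q e x.1.1 x.2)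
  map_add' f f' := rfl
  map_smul' c f := rfl

lemma rhoT_inj (β) : Function.Injective (rhoT (k := k) (k' := k') d q e β) := by
  intro f f' h
  apply Subtype.ext
  refine inj_T d q e f.2.1 f'.2.1 fun g w hg => ?_
  exact congrFun h (⟨g, hg⟩, w)

lemma rhoS_inj (N : Fin (m + p) → ℕ) (β) :
    Function.Injective (rhoS (k := k) (k' := k') d q e N β) := by
  intro f f' h
  apply Subtype.ext
  refine inj_S d q e f.2.1 f'.2.1 fun X w hX => ?_
  have hg : ∀ l, ((X l)⁻¹).det ≠ 0 := by
    intro l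
    rw [Matrix.det_nonsing_inv, Ring.inverse_eq_inv']
    exact inv_ne_zero (hX l)
  have hii : (fun l => ((X l)⁻¹)⁻¹) = X := by
    funext l
    exact Matrix.nonsing_inv_nonsing_inv _ (IsUnit.mk0 _ (hX l))
  have h1 := congrFun h (⟨fun l => (X l)⁻¹, hg⟩, w)
  have h2 := mul_left_cancel₀
    (Finset.prod_ne_zero_iff.2 fun l _ => pow_ne_zero (N l) (hg l)) h1
  have h3 := congrArg (fun Y => f.1 (toS d q e Y w)) hii
  have h4 := congrArg (fun Y => f'.1 (toS d q e Y w)) hii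
  exact h3.symm.trans (h2.trans h4)

theorem gen (e : ∀ l, Fin d ≃ Fin (k' l) ⊕ Fin (k l)) (N : Fin (m + p) → ℕ) (z : ℤ) (t : Fin n → ℤ) :
    (Squiv m p n).siDim (dimV k d q) (wtV (fun l => (N l : ℤ)) z t) =
      (StildeQuiv m p n).siDim (dimV k' d q)
        (wtV (fun l => -(N l : ℤ)) (z + ∑ l, (N l : ℤ)) t) := by
  unfold FinQuiver.siDim
  have : LinearMap.range (rhoS (k := k) (k' := k') d q e N (wtV (fun l => (N l : ℤ)) z t)) =
      LinearMap.range (rhoT (k := k) (k' := k') d q e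
        (wtV (fun l => -(N l : ℤ)) (z + ∑ l, (N l : ℤ)) t)) := by
    apply le_antisymm
    · rintro _ ⟨⟨f, hf⟩, rfl⟩
      obtain ⟨ft, h1, h2⟩ := transA d q e N z t hf
      refine ⟨⟨ft, relT d q e N z t h2 hf h1⟩, ?_⟩
      funext x
      exact h2 x.1.1 x.2 x.1.2
    · rintro _ ⟨⟨f, hf⟩, rfl⟩
      obtain ⟨fs, h1, h2⟩ := transB d q e N _ t hf
      refine ⟨⟨fs, relS d q e N z t h2 h1 hf⟩, ?_⟩
      funext x
      exact (h2 x.1.1 x.2 x.1.2).symm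
  have h1 := LinearMap.finrank_range_of_inj (rhoS_inj (k' := k') d q e N
    (wtV (fun l => (N l : ℤ)) z t))
  have h2 := LinearMap.finrank_range_of_inj (rhoT_inj (k := k) d q e
    (wtV (fun l => -(N l : ℤ)) (z + ∑ l, (N l : ℤ)) t))
  have h3 := congrArg (fun S : Submodule ℂ _ => Module.finrank ℂ S) this
  exact h1.symm.trans (h3.trans h2)

end gen
end Refl
/-- `dim SI(𝒮, β)_{σ_{a,b}} = dim SI(𝒮̃, β̃)_{σ̃_{a,b}}`, where `𝒮̃` is
obtained from the star quiver `𝒮` by reflecting at the source vertices `x₁,…,x_{m+p}`. -/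
theorem siDim_S_eq_siDim_Stilde
    (m n p : ℕ) (hm : 0 < m) (hn : 0 < n) (hp : 0 < p)
    (a : Fin m → ℕ) (b : Fin n → ℕ) (N : ℕ)
    (hNa : N = ∑ i : Fin m, a i) (hNb : N = ∑ j : Fin n, b j) :
    (Squiv m p n).siDim (betaS m p n) (sigmaS m p n a b N) =
      (StildeQuiv m p n).siDim (betaStilde m p n) (sigmaStilde m p n a b N) := by
  have hmp : 1 ≤ p * m := Nat.mul_pos hp hm
  let k : Fin (m + p) → ℕ := fun l => if l.val < m then 1 else m
  let k' : Fin (m + p) → ℕ := fun l => if l.val < m then p * m - 1 else m * (p - 1)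
  let M : Fin (m + p) → ℕ := fun l => if h : l.val < m then a ⟨l.val, h⟩ else N
  have hk : ∀ l, p * m = k' l + k l := by
    intro l
    simp only [k, k']
    split_ifs
    · omega
    · obtain ⟨r, rfl⟩ : ∃ r, p = r + 1 := ⟨p - 1, by omega⟩
      simp only [Nat.add_sub_cancel]
      ring
  have e : ∀ l, Fin (p * m) ≃ Fin (k' l) ⊕ Fin (k l) := fun l =>
    (finCongr (hk l)).trans finSumFinEquiv.symm
  have hM : ∑ l, (M l : ℤ) = N + p * N := by
    rw [Fin.sum_univ_add]
    have h1 : ∀ i : Fin m, (M (Fin.castAdd p i) : ℤ) = a i := by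
      intro i
      simp [M]
    have h2 : ∀ i : Fin p, (M (Fin.natAdd m i) : ℤ) = N := by
      intro i
      simp [M]
    simp only [h1, h2]
    rw [hNa]
    simp
  have e1 : betaS m p n = Refl.dimV k (p * m) (fun _ => 1) := by
    funext v
    rcases v with l | _ | j
    · rfl
    · exact Nat.mul_comm m p
    · rfl
  have e2 : betaStilde m p n = Refl.dimV k' (p * m) (fun _ => 1) := by
    funext v
    rcases v with l | _ | j <;> rfl
  have e3 : sigmaS m p n a b N = Refl.wtV (fun l => (M l : ℤ)) (-(N : ℤ)) (fun j => -(b j : ℤ)) := by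
    funext v
    rcases v with l | _ | j
    · simp only [sigmaS, Refl.wtV, M]
      split_ifs <;> rfl
    · rfl
    · rfl
  have e4 : sigmaStilde m p n a b N = Refl.wtV (fun l => -(M l : ℤ))
      (-(N : ℤ) + ∑ l, (M l : ℤ)) (fun j => -(b j : ℤ)) := by
    funext v
    rcases v with l | _ | j
    · simp only [sigmaStilde, Refl.wtV, M]
      split_ifs <;> rfl
    · simp only [sigmaStilde, Refl.wtV, hM]
      ring
    · rfl
  rw [e1, e2, e3, e4]
  exact Refl.gen (p * m) (fun _ => 1) e M _ _
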